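/- Let a, b > 0 and let U : ℝ → ℝ be three times continuously differentiable with U(0) = 0, U'(y)·y > 0 for all y ≠ 0 and U''(0) > 0; assume moreover that for every K > 0 there exists C₀ > 0 such that -U'(y+z+C₀) + U'(y) + U''(y)z < 0 and -U'(y+z-C₀) + U'(y) + U''(y)z > 0 for all y ∈ [-b,a] and all z ∈ [-K,K]. Fix x ∈ [-b,a] and let Y : [0,∞) → [-b,a] be differentiable with Y(0) = x and Y'(t) = -U'(Y(t)) for all t. Then there exist constants C_R > 0 and C_E ∈ (0,1], not depending on T, x or the noise path, with the following property: for every T > 0, every bounded measurable ζ : [0,T] → ℝ with ζ(0) = 0 and sup_{t∈[0,T]}|ζ(t)| < C_E, and every bounded measurable x̃ : [0,T] → ℝ satisfying x̃(t) = x - ∫₀^t U'(x̃(s)) ds + ζ(t) for all t ∈ [0,T], the remainder R(t) := x̃(t) - Y(t) - Z(t), where Z(t) := ζ(t) - ∫₀^t ζ(s) U''(Y(s)) e^{-∫_s^t U''(Y(u)) du} ds, satisfies sup_{t∈[0,T]} |R(t)| ≤ C_R·(sup_{t∈[0,T]}|ζ(t)|)². -/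

import Mathlib

open MeasureTheory Set Filter Topology

theorem hasDerivAt_integral_zero {k : ℝ → ℝ} (hk : Continuous k) (t : ℝ) :
    HasDerivAt (fun τ ↦ ∫ u in (0 : ℝ)..τ, k u) (k t) t :=
  intervalIntegral.integral_hasDerivAt_right (hk.intervalIntegrable _ _)
    (hk.stronglyMeasurableAtFilter _ _) hk.continuousAt

theorem exp_neg_integral_eq_mul {k : ℝ → ℝ} (hk : Continuous k) (s t : ℝ) :
    Real.exp (-∫ u in s..t, k u) =
      Real.exp (-∫ u in (0 : ℝ)..t, k u) * Real.exp (∫ u in (0 : ℝ)..s, k u) := by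
  rw [← Real.exp_add, ← intervalIntegral.integral_interval_sub_left
    (hk.intervalIntegrable 0 t) (hk.intervalIntegrable 0 s)]
  congr 1
  ring

theorem continuous_exp_integral {k : ℝ → ℝ} (hk : Continuous k) :
    Continuous fun s ↦ Real.exp (∫ u in (0 : ℝ)..s, k u) :=
  Real.continuous_exp.comp
    (continuous_iff_continuousAt.2 fun t ↦ (hasDerivAt_integral_zero hk t).continuousAt)

theorem integral_exp_neg_mul {k : ℝ → ℝ} (hk : Continuous k) (g : ℝ → ℝ) (t : ℝ) :
    ∫ s in (0 : ℝ)..t, Real.exp (-∫ u in s..t, k u) * g s =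
      Real.exp (-∫ u in (0 : ℝ)..t, k u) *
        ∫ s in (0 : ℝ)..t, Real.exp (∫ u in (0 : ℝ)..s, k u) * g s := by
  rw [← intervalIntegral.integral_const_mul]
  exact intervalIntegral.integral_congr fun s _ ↦ by
    simp only [exp_neg_integral_eq_mul hk s t, mul_assoc]

/-- Variation of constants for a primitive `∫ h`, with `h` merely integrable. -/
theorem integral_eq_integral_exp_neg_mul {k h : ℝ → ℝ} (hk : Continuous k) {t : ℝ}
    (hh : IntervalIntegrable h volume 0 t) :
    ∫ s in (0 : ℝ)..t, h s =
      ∫ s in (0 : ℝ)..t, Real.exp (-∫ u in s..t, k u) *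
        (h s + k s * ∫ r in (0 : ℝ)..s, h r) := by
  set E : ℝ → ℝ := fun s ↦ Real.exp (∫ u in (0 : ℝ)..s, k u) with hE
  have hEd : ∀ s, HasDerivAt E (E s * k s) s := fun s ↦ (hasDerivAt_integral_zero hk s).exp
  have hEc : ContDiff ℝ 1 E := by
    rw [contDiff_one_iff_deriv]
    refine ⟨fun s ↦ (hEd s).differentiableAt, ?_⟩
    rw [funext fun s ↦ (hEd s).deriv]
    exact (continuous_exp_integral hk).mul hk
  have hw := hh.absolutelyContinuousOnInterval_intervalIntegral (c := 0) (by simp)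
  have key := (hEc.contDiffOn (s := uIcc 0 t)).absolutelyContinuousOnInterval
    |>.integral_deriv_mul_eq_sub hw
  have hcongr : ∫ s in (0 : ℝ)..t, E s * (h s + k s * ∫ r in (0 : ℝ)..s, h r) =
      E t * ∫ s in (0 : ℝ)..t, h s := by
    simp only [intervalIntegral.integral_same, mul_zero, sub_zero] at key
    rw [← key]
    apply intervalIntegral.integral_congr_ae
    filter_upwards [hh.ae_hasDerivAt_integral] with s hs hst
    rw [(hs (uIoc_subset_uIcc hst) 0 (by simp)).deriv, (hEd s).deriv]
    ring
  rw [integral_exp_neg_mul hk, hcongr, ← mul_assoc, ← Real.exp_add, neg_add_cancel, Real.exp_zero,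
    one_mul]

theorem continuousOn_integral_exp_neg_mul {k g : ℝ → ℝ} (hk : Continuous k) {T : ℝ} (hT : 0 ≤ T)
    (hg : IntervalIntegrable g volume 0 T) :
    ContinuousOn (fun t ↦ ∫ s in (0 : ℝ)..t, Real.exp (-∫ u in s..t, k u) * g s) (Icc 0 T) := by
  simp_rw [integral_exp_neg_mul hk, Real.exp_neg]
  have hE := continuous_exp_integral hk
  refine (hE.inv₀ fun _ ↦ (Real.exp_pos _).ne').continuousOn.mul ?_
  rw [← uIcc_of_le hT]
  exact ((hg.continuousOn_mul hE.continuousOn).absolutelyContinuousOnInterval_intervalIntegral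
    (by simp)).continuousOn

/-- The remainder after the first-order term solves a linear equation driven by the
nonlinear part of `h`. -/
theorem sub_first_order_eq_integral {k h ζ d : ℝ → ℝ} (hk : Continuous k) {t : ℝ} (ht : 0 ≤ t)
    (hh : IntervalIntegrable h volume 0 t) (hζ : IntervalIntegrable ζ volume 0 t)
    (hd : ∀ τ ∈ Icc 0 t, d τ = ζ τ + ∫ s in (0 : ℝ)..τ, h s) :
    d t - (ζ t - ∫ s in (0 : ℝ)..t, ζ s * k s * Real.exp (-∫ u in s..t, k u)) =
      ∫ s in (0 : ℝ)..t, Real.exp (-∫ u in s..t, k u) * (h s + k s * d s) := by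
  have hEt : Continuous fun s ↦ Real.exp (-∫ u in s..t, k u) := by
    rw [funext fun s ↦ exp_neg_integral_eq_mul hk s t]
    exact continuous_const.mul (continuous_exp_integral hk)
  have hw : ContinuousOn (fun s ↦ ∫ r in (0 : ℝ)..s, h r) (uIcc 0 t) :=
    (hh.absolutelyContinuousOnInterval_intervalIntegral (by simp)).continuousOn
  have h1 : IntervalIntegrable
      (fun s ↦ Real.exp (-∫ u in s..t, k u) * (h s + k s * ∫ r in (0 : ℝ)..s, h r)) volume 0 t :=
    (hh.add (hk.continuousOn.mul hw).intervalIntegrable).continuousOn_mul hEt.continuousOn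
  have h2 : IntervalIntegrable (fun s ↦ ζ s * k s * Real.exp (-∫ u in s..t, k u)) volume 0 t :=
    (hζ.mul_continuousOn hk.continuousOn).mul_continuousOn hEt.continuousOn
  rw [hd t ⟨ht, le_rfl⟩, integral_eq_integral_exp_neg_mul hk hh, add_sub_sub_cancel,
    ← intervalIntegral.integral_add h1 h2]
  refine intervalIntegral.integral_congr fun s hs ↦ ?_
  rw [uIcc_of_le ht] at hs
  simp only [hd s hs]
  ring

/-- Second-order Taylor bound, uniform over a compact interval of base points. -/
theorem exists_taylor_bound {f : ℝ → ℝ} (hf : ContDiff ℝ 2 f) (p q : ℝ) :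
    ∃ L : ℝ, 0 ≤ L ∧ ∀ y ∈ Icc p q, ∀ d : ℝ, |d| ≤ 1 →
      |f (y + d) - f y - deriv f y * d| ≤ L * d ^ 2 := by
  have hf' : ContDiff ℝ 1 (deriv f) := (contDiff_succ_iff_deriv (n := 1)).1 hf |>.2.2
  obtain ⟨L, hL⟩ := (hf'.contDiffOn (s := Icc (p - 1) (q + 1))).exists_lipschitzOnWith one_ne_zero
    (convex_Icc _ _) isCompact_Icc
  refine ⟨L, L.2, fun y hy d hd ↦ ?_⟩
  have hd' := abs_le.1 hd
  have hdiff : ∀ z, HasDerivAt f (deriv f z) z := fun z ↦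
    (hf.differentiable (by norm_num) z).hasDerivAt
  have hder : ∀ z ∈ uIcc y (y + d), HasDerivWithinAt (fun z ↦ f z - deriv f y * z)
      (deriv f z - deriv f y) (uIcc y (y + d)) z := fun z _ ↦ by
    simpa using ((hdiff z).fun_sub ((hasDerivAt_id' z).const_mul (deriv f y))).hasDerivWithinAt
  have hbd : ∀ z ∈ uIcc y (y + d), ‖deriv f z - deriv f y‖ ≤ L * |d| := fun z hz ↦ by
    have hzy : |z - y| ≤ |d| := by simpa using abs_sub_left_of_mem_uIcc hz
    have hzd := abs_le.1 (hzy.trans hd)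
    have := hL.norm_sub_le (x := z) (y := y) ⟨by linarith [hy.1], by linarith [hy.2]⟩
      ⟨by linarith [hy.1], by linarith [hy.2]⟩
    exact this.trans (mul_le_mul_of_nonneg_left hzy L.2)
  have := (convex_uIcc y (y + d)).norm_image_sub_le_of_norm_hasDerivWithin_le hder hbd
    left_mem_uIcc right_mem_uIcc
  rw [Real.norm_eq_abs, Real.norm_eq_abs, add_sub_cancel_left, mul_assoc, abs_mul_abs_self] at this
  convert this using 2 <;> ring

/-- First-exit argument: a strict bound that propagates from `[0, τ)` to `τ` holds throughout. -/
theorem abs_lt_of_continuousOn_of_step {R : ℝ → ℝ} {T μ : ℝ} (hR : ContinuousOn R (Icc 0 T))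
    (hstep : ∀ τ ∈ Icc 0 T, (∀ s ∈ Ico 0 τ, |R s| < μ) → |R τ| < μ) :
    ∀ t ∈ Icc 0 T, |R t| < μ := by
  by_contra! hcon
  obtain ⟨t, ht, htμ⟩ := hcon
  have hcl : IsCompact (Icc 0 T ∩ (fun s ↦ |R s|) ⁻¹' Ici μ) :=
    isCompact_Icc.of_isClosed_subset
      (hR.abs.preimage_isClosed_of_isClosed isClosed_Icc isClosed_Ici) inter_subset_left
  obtain ⟨τ, ⟨hτ, hτμ⟩, hmin⟩ := hcl.exists_isLeast ⟨t, ht, htμ⟩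
  refine (hstep τ hτ fun s hs ↦ ?_).not_ge hτμ
  by_contra! hsμ
  exact (hmin ⟨⟨hs.1, hs.2.le.trans hτ.2⟩, hsμ⟩).not_gt hs.2

/-- Exponential contraction of the linearised flow along trajectories of `Ẏ = -f(Y)`. -/
theorem exists_exp_neg_integral_le {f : ℝ → ℝ} (hf : ContDiff ℝ 1 f)
    (hf0 : ∀ y, y ≠ 0 → f y ≠ 0) (hf0' : 0 < deriv f 0) (p q : ℝ) :
    ∃ c > 0, ∃ C > 0, ∀ Y : ℝ → ℝ, Continuous Y → (∀ t > 0, HasDerivAt Y (-f (Y t)) t) →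
      (∀ t ≥ 0, Y t ∈ Icc p q) → ∀ s t, 0 ≤ s → s ≤ t →
        Real.exp (-∫ u in s..t, deriv f (Y u)) ≤ C * Real.exp (-(c * (t - s))) := by
  have hf'c : Continuous (deriv f) := hf.continuous_deriv_one
  set c := deriv f 0 / 2 with hc
  have hc0 : 0 < c := half_pos hf0'
  set g : ℝ → ℝ := fun y ↦ max (c - deriv f y) 0 / f y with hg
  have hgf : ∀ y, g y * f y = max (c - deriv f y) 0 := fun y ↦ by
    by_cases hy : y = 0
    · subst hy
      have : max (c - deriv f 0) 0 = 0 := max_eq_right (by linarith)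
      simp [hg, this]
    · exact div_mul_cancel₀ _ (hf0 y hy)
  have hgc : Continuous g := by
    refine continuous_iff_continuousAt.2 fun y ↦ ?_
    by_cases hy : y = 0
    · subst hy
      have : ∀ᶠ y in 𝓝 0, (0 : ℝ) = g y := by
        filter_upwards [hf'c.continuousAt.eventually (lt_mem_nhds (show c < deriv f 0 by linarith))]
          with y hy
        simp [hg, max_eq_right (sub_nonpos.2 hy.le)]
      exact continuousAt_const.congr this
    · exact ((continuous_const.sub hf'c).max continuous_const).continuousAt.div
        hf.continuous.continuousAt (hf0 y hy)
  set Q : ℝ → ℝ := fun y ↦ ∫ v in (0 : ℝ)..y, g v with hQ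
  have hQd : ∀ y, HasDerivAt Q (g y) y := hasDerivAt_integral_zero hgc
  have hQc : Continuous Q := continuous_iff_continuousAt.2 fun y ↦ (hQd y).continuousAt
  obtain ⟨B, hB⟩ := isCompact_Icc.exists_bound_of_continuousOn (s := Icc p q) hQc.continuousOn
  refine ⟨c, hc0, Real.exp (2 * B), Real.exp_pos _, fun Y hY hYd hYm s t hs hst ↦ ?_⟩
  have hk : Continuous fun u ↦ deriv f (Y u) := hf'c.comp hY
  set F : ℝ → ℝ := fun τ ↦ (∫ u in (0 : ℝ)..τ, deriv f (Y u)) - c * τ - Q (Y τ) with hF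
  have hFd : ∀ τ > 0, HasDerivAt F (deriv f (Y τ) - c + max (c - deriv f (Y τ)) 0) τ := by
    intro τ hτ
    rw [← hgf]
    exact (((hasDerivAt_integral_zero hk τ).fun_sub ((hasDerivAt_id' τ).const_mul c)).fun_sub
      ((hQd (Y τ)).comp τ (hYd τ hτ))).congr_deriv (by ring)
  have hFc : Continuous F :=
    ((continuous_iff_continuousAt.2 fun t ↦ (hasDerivAt_integral_zero hk t).continuousAt).sub
      (continuous_const.mul continuous_id)).sub (hQc.comp hY)
  have hmono : MonotoneOn F (Ici 0) := by
    refine monotoneOn_of_deriv_nonneg (convex_Ici 0) hFc.continuousOn ?_ ?_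
    · rw [interior_Ici]
      exact fun τ hτ ↦ (hFd τ hτ).differentiableAt.differentiableWithinAt
    · rw [interior_Ici]
      intro τ hτ
      rw [(hFd τ hτ).deriv]
      linarith [le_max_left (c - deriv f (Y τ)) 0]
  have hle : F s ≤ F t := hmono hs (hs.trans hst : (0 : ℝ) ≤ t) hst
  have hsplit := intervalIntegral.integral_interval_sub_left
    (hk.intervalIntegrable (μ := volume) 0 t) (hk.intervalIntegrable 0 s)
  have h1 := abs_le.1 (hB _ (hYm s hs))
  have h2 := abs_le.1 (hB _ (hYm t (hs.trans hst)))
  rw [← Real.exp_add]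
  refine Real.exp_le_exp.2 ?_
  simp only [hF] at hle
  linarith [h1.1, h2.1]

theorem integral_exp_neg_mul_sub_le {c : ℝ} (hc : 0 < c) (t : ℝ) :
    ∫ s in (0 : ℝ)..t, Real.exp (-(c * (t - s))) ≤ c⁻¹ := by
  have hd : ∀ s, HasDerivAt (fun s ↦ c⁻¹ * Real.exp (-(c * (t - s))))
      (Real.exp (-(c * (t - s)))) s := fun s ↦
    (((((hasDerivAt_id' s).const_sub t).const_mul c).fun_neg).exp.const_mul c⁻¹).congr_deriv
      (by field_simp)
  rw [intervalIntegral.integral_eq_sub_of_hasDerivAt (fun s _ ↦ hd s)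
    (Continuous.intervalIntegrable (by fun_prop) _ _)]
  have : 0 < c⁻¹ * Real.exp (-(c * (t - 0))) := by positivity
  simp only [sub_self, mul_zero, neg_zero, Real.exp_zero, mul_one]
  linarith

theorem abs_integral_exp_neg_mul_le {k g : ℝ → ℝ} {c C G t : ℝ} (hc : 0 < c) (hC : 0 ≤ C)
    (ht : 0 ≤ t)
    (hk : ∀ s ∈ Icc 0 t, Real.exp (-∫ u in s..t, k u) ≤ C * Real.exp (-(c * (t - s))))
    (hG : 0 ≤ G) (hg : ∀ s ∈ Ico 0 t, |g s| ≤ G) :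
    |∫ s in (0 : ℝ)..t, Real.exp (-∫ u in s..t, k u) * g s| ≤ C * c⁻¹ * G := by
  have hle : |∫ s in (0 : ℝ)..t, Real.exp (-∫ u in s..t, k u) * g s| ≤
      ∫ s in (0 : ℝ)..t, C * G * Real.exp (-(c * (t - s))) := by
    have hexp : IntervalIntegrable (fun s ↦ C * G * Real.exp (-(c * (t - s)))) volume 0 t :=
      Continuous.intervalIntegrable (by fun_prop) _ _
    rw [← Real.norm_eq_abs]
    refine intervalIntegral.norm_integral_le_of_norm_le ht ?_ hexp
    filter_upwards [Measure.ae_ne (volume : Measure ℝ) t] with s hst hs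
    rw [norm_mul, Real.norm_eq_abs, Real.abs_exp, Real.norm_eq_abs, mul_right_comm]
    exact mul_le_mul (hk s ⟨hs.1.le, hs.2⟩) (hg s ⟨hs.1.le, lt_of_le_of_ne hs.2 hst⟩)
      (abs_nonneg _) (by positivity)
  rw [intervalIntegral.integral_const_mul] at hle
  calc _ ≤ _ := hle
    _ ≤ C * G * c⁻¹ := by gcongr; exact integral_exp_neg_mul_sub_le hc t
    _ = _ := by ring

theorem Measurable.intervalIntegrable_of_abs_le {g : ℝ → ℝ} (hg : Measurable g) {T M : ℝ}
    (hT : 0 ≤ T) (hM : ∀ t ∈ Icc 0 T, |g t| ≤ M) : IntervalIntegrable g volume 0 T := by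
  refine (intervalIntegrable_const (c := M)).mono_fun' hg.aestronglyMeasurable ?_
  refine (ae_restrict_iff' measurableSet_uIoc).2 (.of_forall fun t ht ↦ ?_)
  rw [uIoc_of_le hT] at ht
  exact hM t (Ioc_subset_Icc_self ht)

/-- Uniform quadratic bound for the remainder along globally continuous trajectories. -/
theorem exists_remainder_bound {f : ℝ → ℝ} (hf : ContDiff ℝ 2 f)
    (hf0 : ∀ y, y ≠ 0 → f y ≠ 0) (hf0' : 0 < deriv f 0) (p q : ℝ) :
    ∃ C_R > 0, ∃ C_E > 0, C_E ≤ 1 ∧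
      ∀ Y : ℝ → ℝ, Continuous Y → (∀ t > 0, HasDerivAt Y (-f (Y t)) t) →
        (∀ t ≥ 0, Y t ∈ Icc p q) →
        ∀ T > 0, ∀ ζ X : ℝ → ℝ, Measurable ζ → Measurable X →
          (∃ N, ∀ t ∈ Icc 0 T, |X t| ≤ N) →
          (∀ t ∈ Icc 0 T, X t = Y 0 - (∫ s in (0 : ℝ)..t, f (X s)) + ζ t) →
          ∀ M < C_E, (∀ t ∈ Icc 0 T, |ζ t| ≤ M) → ∀ t ∈ Icc 0 T,
            |X t - Y t - (ζ t - ∫ s in (0 : ℝ)..t,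
                ζ s * deriv f (Y s) * Real.exp (-∫ u in s..t, deriv f (Y u)))| ≤ C_R * M ^ 2 := by
  have hf1 : ContDiff ℝ 1 f := hf.of_le (by norm_num)
  obtain ⟨c, hc, C, hC, hdecay⟩ := exists_exp_neg_integral_le hf1 hf0 hf0' p q
  obtain ⟨L, hL, htaylor⟩ := exists_taylor_bound hf p q
  have hf'c : Continuous (deriv f) := hf1.continuous_deriv_one
  obtain ⟨K', hK'⟩ := isCompact_Icc.exists_bound_of_continuousOn (s := Icc p q) hf'c.continuousOn
  obtain ⟨K, hK, hK0⟩ : ∃ K, (∀ y ∈ Icc p q, |deriv f y| ≤ K) ∧ 0 ≤ K :=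
    ⟨max K' 0, fun y hy ↦ (hK' y hy).trans (le_max_left _ _), le_max_right _ _⟩
  set A := C * c⁻¹ with hA
  have hA0 : 0 < A := by positivity
  set B := 1 + A * K with hB
  have hB0 : 0 < B := by positivity
  set C_R := A * ((L + 1) * (B + 1) ^ 2) with hCR
  have hCR0 : 0 < C_R := by positivity
  refine ⟨C_R, hCR0, min (B + 1)⁻¹ C_R⁻¹, by positivity,
    (min_le_left _ _).trans (inv_le_one_of_one_le₀ (by linarith)), ?_⟩
  intro Y hY hYd hYm T hT ζ X hζm hXm ⟨N, hN⟩ hX M hM hζM t ht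
  have hM0 : 0 ≤ M := (abs_nonneg _).trans (hζM 0 ⟨le_rfl, hT.le⟩)
  set k : ℝ → ℝ := fun s ↦ deriv f (Y s) with hk_def
  have hk : Continuous k := hf'c.comp hY
  set d : ℝ → ℝ := fun s ↦ X s - Y s with hd_def
  set h : ℝ → ℝ := fun s ↦ f (Y s) - f (X s) with hh_def
  have hker : ∀ τ ∈ Icc 0 T, ∀ s ∈ Icc 0 τ,
      Real.exp (-∫ u in s..τ, k u) ≤ C * Real.exp (-(c * (τ - s))) :=
    fun τ _ s hs ↦ hdecay Y hY hYd hYm s τ hs.1 hs.2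
  have hζi := hζm.intervalIntegrable_of_abs_le hT.le hζM
  have hXi := hXm.intervalIntegrable_of_abs_le hT.le hN
  obtain ⟨F, hF⟩ := isCompact_Icc.exists_bound_of_continuousOn (s := Icc (-N) N)
    hf.continuous.continuousOn
  have hfXi : IntervalIntegrable (fun s ↦ f (X s)) volume 0 T :=
    (hf.continuous.measurable.comp hXm).intervalIntegrable_of_abs_le hT.le
      fun s hs ↦ hF _ (abs_le.1 (hN s hs))
  have hfYi : ∀ τ, IntervalIntegrable (fun s ↦ f (Y s)) volume 0 τ := fun τ ↦
    (hf.continuous.comp hY).intervalIntegrable _ _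
  have hhi : IntervalIntegrable h volume 0 T := (hfYi T).sub hfXi
  have hsub : ∀ τ ∈ Icc 0 T, uIcc 0 τ ⊆ uIcc 0 T := fun τ hτ ↦ by
    rw [uIcc_of_le hτ.1, uIcc_of_le hT.le]
    exact Icc_subset_Icc_right hτ.2
  have hd : ∀ τ ∈ Icc 0 T, d τ = ζ τ + ∫ s in (0 : ℝ)..τ, h s := by
    intro τ hτ
    have hYτ : ∫ s in (0 : ℝ)..τ, -f (Y s) = Y τ - Y 0 :=
      intervalIntegral.integral_eq_sub_of_hasDerivAt_of_le hτ.1 hY.continuousOn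
        (fun s hs ↦ hYd s hs.1) (hfYi τ).neg
    rw [intervalIntegral.integral_neg] at hYτ
    simp only [hd_def, hh_def]
    rw [intervalIntegral.integral_sub (hfYi τ) (hfXi.mono_set (hsub τ hτ)), hX τ hτ]
    linarith
  have hgi : IntervalIntegrable (fun s ↦ h s + k s * d s) volume 0 T :=
    hhi.add ((hXi.sub (hY.intervalIntegrable _ _)).continuousOn_mul hk.continuousOn)
  set R : ℝ → ℝ := fun τ ↦
    d τ - (ζ τ - ∫ s in (0 : ℝ)..τ, ζ s * k s * Real.exp (-∫ u in s..τ, k u)) with hR_def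
  have hR : ∀ τ ∈ Icc 0 T,
      R τ = ∫ s in (0 : ℝ)..τ, Real.exp (-∫ u in s..τ, k u) * (h s + k s * d s) := fun τ hτ ↦
    sub_first_order_eq_integral hk hτ.1 (hhi.mono_set (hsub τ hτ)) (hζi.mono_set (hsub τ hτ))
      fun s hs ↦ hd s ⟨hs.1, hs.2.trans hτ.2⟩
  have hRc : ContinuousOn R (Icc 0 T) :=
    (continuousOn_integral_exp_neg_mul hk hT.le hgi).congr hR
  have hZ : ∀ τ ∈ Icc 0 T, |d τ - R τ| ≤ B * M := by
    intro τ hτ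
    have hV : |∫ s in (0 : ℝ)..τ, Real.exp (-∫ u in s..τ, k u) * (ζ s * k s)| ≤ A * (M * K) :=
      abs_integral_exp_neg_mul_le hc hC.le hτ.1 (hker τ hτ) (by positivity) fun s hs ↦ by
        rw [abs_mul]
        exact mul_le_mul (hζM s ⟨hs.1, hs.2.le.trans hτ.2⟩) (hK _ (hYm s hs.1)) (abs_nonneg _) hM0
    simp only [hR_def, sub_sub_cancel, mul_comm _ (Real.exp _)]
    calc _ ≤ _ := abs_sub _ _
      _ ≤ M + A * (M * K) := add_le_add (hζM τ hτ) hV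
      _ = B * M := by ring
  have hstep : ∀ μ, M < μ → μ < min (B + 1)⁻¹ C_R⁻¹ → ∀ τ ∈ Icc 0 T,
      (∀ s ∈ Ico 0 τ, |R s| < μ) → |R τ| ≤ C_R * μ ^ 2 := by
    intro μ hMμ hμ τ hτ hs
    have hμ1 : (B + 1) * μ ≤ 1 := by
      rw [mul_comm, ← le_div_iff₀ (by positivity), one_div]
      exact hμ.le.trans (min_le_left _ _)
    rw [hR τ hτ, hCR, mul_assoc]
    refine abs_integral_exp_neg_mul_le hc hC.le hτ.1 (hker τ hτ) (by positivity) fun s hsτ ↦ ?_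
    have hds : |d s| ≤ (B + 1) * μ := by
      have h1 := hZ s ⟨hsτ.1, hsτ.2.le.trans hτ.2⟩
      have h2 := abs_add_le (d s - R s) (R s)
      rw [sub_add_cancel] at h2
      nlinarith [hs s hsτ]
    have ht := htaylor (Y s) (hYm s hsτ.1) (d s) (hds.trans hμ1)
    have hX' : Y s + d s = X s := by simp [hd_def]
    have hgs : h s + k s * d s = -(f (Y s + d s) - f (Y s) - deriv f (Y s) * d s) := by
      simp only [hX', hh_def, hk_def]
      ring
    rw [hgs, abs_neg]
    have hsq : d s ^ 2 ≤ ((B + 1) * μ) ^ 2 := sq_le_sq' (abs_le.1 hds).1 (abs_le.1 hds).2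
    calc _ ≤ L * d s ^ 2 := ht
      _ ≤ (L + 1) * ((B + 1) * μ) ^ 2 := by gcongr; linarith
      _ = (L + 1) * (B + 1) ^ 2 * μ ^ 2 := by ring
  have hbound : ∀ μ, M < μ → μ < min (B + 1)⁻¹ C_R⁻¹ → |R t| ≤ C_R * μ ^ 2 := by
    intro μ hMμ hμ
    have hμ0 : 0 < μ := hM0.trans_lt hMμ
    have hμ1 : C_R * μ < 1 := by
      rw [mul_comm, ← lt_div_iff₀ hCR0, one_div]
      exact hμ.trans_le (min_le_right _ _)
    have hlt := abs_lt_of_continuousOn_of_step hRc fun τ hτ hs ↦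
      (hstep μ hMμ hμ τ hτ hs).trans_lt (by nlinarith)
    exact hstep μ hMμ hμ t ht fun s hs ↦ hlt s ⟨hs.1, hs.2.le.trans ht.2⟩
  have hlim : Tendsto (fun μ ↦ C_R * μ ^ 2) (𝓝[>] M) (𝓝 (C_R * M ^ 2)) :=
    (Continuous.tendsto (by fun_prop) M).mono_left nhdsWithin_le_nhds
  refine ge_of_tendsto hlim ?_
  filter_upwards [Ioo_mem_nhdsGT hM] with μ hμ using hbound μ hμ.1 hμ.2

/-- Lemma 5 of the paper (deterministic content): for the dynamics `ẋ = -U'(x)`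
perturbed by a uniformly small path `ζ`, the deviation from the deterministic
trajectory `Y` of `Ẏ = -U'(Y)`, after subtracting the first-order
variation-of-constants term `Z`, is quadratically small in `sup |ζ|`, uniformly in
the time horizon `T`, the starting point `x ∈ [-b,a]` and the noise path. The
hypothesis "`sup_{[0,T]} |ζ| < C_E`" is expressed via a bound `M < C_E`, and the
conclusion "`sup_{[0,T]} |R| ≤ C_R (sup |ζ|)²`" pointwise with that bound `M`. -/
theorem remainder_quadratic_bound (a b : ℝ) (ha : 0 < a) (hb : 0 < b)
    (U : ℝ → ℝ) (hU : ContDiff ℝ 3 U) (hU0 : U 0 = 0)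
    (hsign : ∀ y : ℝ, y ≠ 0 → deriv U y * y > 0)
    (hcurv : 0 < deriv (deriv U) 0)
    (hbar : ∀ K : ℝ, 0 < K → ∃ C₀ : ℝ, 0 < C₀ ∧
      ∀ y ∈ Set.Icc (-b) a, ∀ z ∈ Set.Icc (-K) K,
        (-deriv U (y + z + C₀) + deriv U y + deriv (deriv U) y * z < 0) ∧
        (-deriv U (y + z - C₀) + deriv U y + deriv (deriv U) y * z > 0)) :
    ∃ C_R : ℝ, 0 < C_R ∧ ∃ C_E : ℝ, 0 < C_E ∧ C_E ≤ 1 ∧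
      ∀ x ∈ Set.Icc (-b) a, ∀ Y : ℝ → ℝ, Y 0 = x →
        (∀ t : ℝ, 0 ≤ t → HasDerivAt Y (-deriv U (Y t)) t) →
        (∀ t : ℝ, 0 ≤ t → Y t ∈ Set.Icc (-b) a) →
        ∀ T : ℝ, 0 < T → ∀ ζ x' : ℝ → ℝ, Measurable ζ → Measurable x' → ζ 0 = 0 →
          (∃ Mx : ℝ, ∀ t ∈ Set.Icc (0 : ℝ) T, |x' t| ≤ Mx) →
          (∀ t ∈ Set.Icc (0 : ℝ) T,
            x' t = x - (∫ s in (0 : ℝ)..t, deriv U (x' s)) + ζ t) →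
          ∀ M : ℝ, M < C_E → (∀ t ∈ Set.Icc (0 : ℝ) T, |ζ t| ≤ M) →
            ∀ t ∈ Set.Icc (0 : ℝ) T,
              |x' t - Y t - (ζ t - ∫ s in (0 : ℝ)..t,
                  ζ s * deriv (deriv U) (Y s) *
                    Real.exp (-∫ u in s..t, deriv (deriv U) (Y u)))|
                ≤ C_R * M ^ 2 := by
  have hf : ContDiff ℝ 2 (deriv U) := (contDiff_succ_iff_deriv (n := 2)).1 hU |>.2.2
  have hf0 : ∀ y, y ≠ 0 → deriv U y ≠ 0 := fun y hy h0 ↦ by simpa [h0] using hsign y hy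
  obtain ⟨C_R, hCR, C_E, hCE, hCE1, hmain⟩ := exists_remainder_bound hf hf0 hcurv (-b) a
  refine ⟨C_R, hCR, C_E, hCE, hCE1, ?_⟩
  intro x _ Y hY0 hYd hYm T hT ζ X hζ hXm _ hN hX M hM hζM t ht
  set W : ℝ → ℝ := fun s ↦ Y (max s 0) with hW_def
  have hWY : ∀ s, 0 ≤ s → W s = Y s := fun s hs ↦ by simp [hW_def, max_eq_left hs]
  have hWc : Continuous W :=
    (show ContinuousOn Y (Ici 0) from fun s hs ↦ (hYd s hs).continuousAt.continuousWithinAt)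
      |>.comp_continuous (by fun_prop) fun s ↦ le_max_right s 0
  have hWd : ∀ s > 0, HasDerivAt W (-deriv U (W s)) s := fun s hs ↦ by
    rw [hWY s hs.le]
    refine (hYd s hs.le).congr_of_eventuallyEq ?_
    filter_upwards [lt_mem_nhds hs] with r hr using hWY r hr.le
  have hW0 : W 0 = x := (hWY 0 le_rfl).trans hY0
  have key := hmain W hWc hWd (fun s hs ↦ hWY s hs ▸ hYm s hs) T hT ζ X hζ hXm hN
    (by rwa [hW0]) M hM hζM t ht
  rw [hWY t ht.1] at key
  convert key using 4
  refine intervalIntegral.integral_congr fun s hs ↦ ?_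
  rw [uIcc_of_le ht.1] at hs
  have hin : ∫ u in s..t, deriv (deriv U) (W u) = ∫ u in s..t, deriv (deriv U) (Y u) :=
    intervalIntegral.integral_congr fun u hu ↦ by
      rw [uIcc_of_le hs.2] at hu
      simp only [hWY u (hs.1.trans hu.1)]
  simp only [hin, hWY s hs.1]
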